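/- Let ~ be an indistinguishability relation on Γ*, λ an information-consistent absorbing coloring, and h : Γ* → P a rectangular morphism. Then Y* ∩ P ⊆ P_∀: for every abstract state p ∈ Y* ∩ P and every history τ with h(τ) = p, the player has an almost-sure winning strategy from [τ]~ for the reachability objective. -/

import Mathlib

open MeasureTheory
open scoped Classical

section Games

variable {Γ A P : Type}

/-- Histories are finite words over the alphabet of moves. -/
abbrev Hist (Γ : Type) := List Γ

/-- The information set of a history: all histories indistinguishable from it. -/
def InfoSet (sim : Hist Γ → Hist Γ → Prop) (τ : Hist Γ) : Set (Hist Γ) := {τ' | sim τ' τ}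

/-- An indistinguishability relation: an equivalence relation such that related
histories have the same length, the relation is prefix-closed and actions are visible. -/
structure IsIndist (act : Γ → A) (sim : Hist Γ → Hist Γ → Prop) : Prop where
  equiv : Equivalence sim
  length_eq : ∀ τ τ' : Hist Γ, sim τ τ' → τ.length = τ'.length
  prefix_act : ∀ (τ τ' : Hist Γ) (c c' : Γ),
    sim (τ ++ [c]) (τ' ++ [c']) → sim τ τ' ∧ act c = act c'

/-- A function on histories is information consistent if it is constant on information sets. -/
def InfoConsistent {C : Type} (sim : Hist Γ → Hist Γ → Prop) (lam : Hist Γ → C) : Prop :=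
  ∀ τ τ' : Hist Γ, sim τ τ' → lam τ = lam τ'

/-- The coloring is absorbing: once a winning history, always winning. -/
def Absorbing (lam : Hist Γ → Bool) : Prop :=
  ∀ (τ : Hist Γ) (c : Γ), lam τ = true → lam (τ ++ [c]) = true

/-- A rectangular morphism for the game. -/
structure IsRectMorphism (sim : Hist Γ → Hist Γ → Prop) (lam : Hist Γ → Bool)
    (h : Hist Γ → P) : Prop where
  surj : Function.Surjective h
  rect : ∀ τ τ' : Hist Γ, h τ = h τ' → h '' InfoSet sim τ = h '' InfoSet sim τ'
  morph : ∀ (τ τ' : Hist Γ) (c : Γ), h τ = h τ' → h (τ ++ [c]) = h (τ' ++ [c])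
  refines : ∀ τ τ' : Hist Γ, h τ = h τ' → lam τ = lam τ'

/-- The relation ≈ on abstract states: ≈ = {(h τ, h τ') | τ ~ τ'}. -/
def approx (sim : Hist Γ → Hist Γ → Prop) (h : Hist Γ → P) (p p' : P) : Prop :=
  ∃ τ τ' : Hist Γ, sim τ τ' ∧ h τ = p ∧ h τ' = p'

/-- The extension of ≈ to P ⊕ (P × A). -/
def approxS (sim : Hist Γ → Hist Γ → Prop) (h : Hist Γ → P) :
    (P ⊕ P × A) → (P ⊕ P × A) → Prop
  | Sum.inl p, Sum.inl p' => approx sim h p p'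
  | Sum.inr (p, a), Sum.inr (p', a') => approx sim h p p' ∧ a = a'
  | _, _ => False

/-- The intr of a set under an equivalence relation. -/
def intr {S : Type} (r : S → S → Prop) (T : Set S) : Set S :=
  {t | ∀ t', r t' t → t' ∈ T}

/-- The set P_F of target (final) abstract states. -/
def targetSet (lam : Hist Γ → Bool) (h : Hist Γ → P) : Set P :=
  {p | ∃ τ : Hist Γ, h τ = p ∧ lam τ = true}

/-- The set P_F viewed inside P ⊕ (P × A). -/
def targetS (A : Type) (lam : Hist Γ → Bool) (h : Hist Γ → P) : Set (P ⊕ P × A) :=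
  Sum.inl '' targetSet lam h

/-- Membership in the predecessor operator. -/
def PreMem (act : Γ → A) (δP : P → Γ → P) (X : Set (P ⊕ P × A)) : (P ⊕ P × A) → Prop
  | Sum.inl p => ∃ a : A, Sum.inr (p, a) ∈ X
  | Sum.inr (p, a) => ∀ c : Γ, act c = a → Sum.inl (δP p c) ∈ X

/-- The predecessor operator Pre on subsets of P ⊕ (P × A). -/
def Pre (act : Γ → A) (δP : P → Γ → P) (X : Set (P ⊕ P × A)) : Set (P ⊕ P × A) :=
  {s | PreMem act δP X s}

lemma Pre_mono (act : Γ → A) (δP : P → Γ → P) : Monotone (Pre act δP) := by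
  intro X Y hXY s hs
  cases s with
  | inl p =>
      obtain ⟨a, ha⟩ := hs
      exact ⟨a, hXY ha⟩
  | inr pa =>
      obtain ⟨p, a⟩ := pa
      exact fun c hc => hXY (hs c hc)

/-- The inner (monotone) operator X ↦ int≈(Y) ∩ (Pre(X) ∪ P_F). -/
def innerOp (sim : Hist Γ → Hist Γ → Prop) (h : Hist Γ → P) (act : Γ → A)
    (δP : P → Γ → P) (lam : Hist Γ → Bool) (Y : Set (P ⊕ P × A)) :
    Set (P ⊕ P × A) →o Set (P ⊕ P × A) :=
  ⟨fun X => intr (approxS sim h) Y ∩ (Pre act δP X ∪ targetS A lam h),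
   fun _ _ hXX' =>
     Set.inter_subset_inter le_rfl (Set.union_subset_union (Pre_mono act δP hXX') le_rfl)⟩

/-- The outer (monotone) operator Y ↦ μX. int≈(Y) ∩ (Pre(X) ∪ P_F). -/
def outerOp (sim : Hist Γ → Hist Γ → Prop) (h : Hist Γ → P) (act : Γ → A)
    (δP : P → Γ → P) (lam : Hist Γ → Bool) :
    Set (P ⊕ P × A) →o Set (P ⊕ P × A) :=
  ⟨fun Y => OrderHom.lfp (innerOp sim h act δP lam Y),
   by
     intro Y Y' hYY'
     exact OrderHom.lfp.monotone fun X =>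
       Set.inter_subset_inter (fun t ht t' hr => hYY' (ht t' hr)) le_rfl⟩

/-- The fixpoint Y* = νY. μX. int≈(Y) ∩ (Pre(X) ∪ P_F). -/
def Ystar (sim : Hist Γ → Hist Γ → Prop) (h : Hist Γ → P) (act : Γ → A)
    (δP : P → Γ → P) (lam : Hist Γ → Bool) : Set (P ⊕ P × A) :=
  OrderHom.gfp (outerOp sim h act δP lam)

/-- A probability distribution on a finite type. -/
structure PDist (X : Type) [Fintype X] where
  f : X → ℝ
  nonneg : ∀ x, 0 ≤ f x
  sum_one : ∑ x, f x = 1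

variable [Fintype Γ] [Fintype A]

/-- A strategy of the player is information consistent. -/
def IsPlayerStrat (sim : Hist Γ → Hist Γ → Prop) (α : Hist Γ → PDist A) : Prop :=
  ∀ τ τ' : Hist Γ, sim τ τ' → α τ = α τ'

/-- A strategy of the environment only plays moves supported by the given action. -/
def IsEnvStrat (act : Γ → A) (β : Hist Γ → A → PDist Γ) : Prop :=
  ∀ (τ : Hist Γ) (a : A) (c : Γ), 0 < (β τ a).f c → act c = a

/-- Plays are infinite sequences of moves. -/
abbrev Play (Γ : Type) := ℕ → Γ

/-- The cylinder set spanned by a finite history. -/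
def Cyl (ρ : List Γ) : Set (Play Γ) := {π | ∀ i : Fin ρ.length, π i.1 = ρ.get i}

/-- The σ-algebra on plays generated by cylinder sets. -/
instance playMS : MeasurableSpace (Play Γ) :=
  .generateFrom {s | ∃ ρ : List Γ, s = Cyl ρ}

/-- The probability that the game, started after history τ, follows a given
further sequence of moves, under strategies α and β. -/
noncomputable def extProb (act : Γ → A) (α : Hist Γ → PDist A) (β : Hist Γ → A → PDist Γ) :
    Hist Γ → List Γ → ℝ
  | _, [] => 1
  | τ, c :: l => (α τ).f (act c) * (β τ (act c)).f c * extProb act α β (τ ++ [c]) l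

/-- μ is the probability measure Pr_τ^{α,β}: its value on every cylinder set is prescribed. -/
def IsPrMeasure (act : Γ → A) (α : Hist Γ → PDist A) (β : Hist Γ → A → PDist Γ)
    (τ : Hist Γ) (μ : Measure (Play Γ)) : Prop :=
  IsProbabilityMeasure μ ∧
  ∀ ρ : Hist Γ, μ (Cyl ρ) =
    if ρ <+: τ then 1
    else if τ <+: ρ then ENNReal.ofReal (extProb act α β τ (ρ.drop τ.length))
    else 0

/-- The reachability event: the set of plays having a finite prefix of color 1. -/
def ReachEvent (lam : Hist Γ → Bool) : Set (Play Γ) :=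
  {π | ∃ n : ℕ, lam (List.ofFn fun i : Fin n => π i.1) = true}

/-- The strategy α is almost-sure winning from the information set [τ]~ for reachability. -/
def ASWinFrom (act : Γ → A) (sim : Hist Γ → Hist Γ → Prop) (lam : Hist Γ → Bool)
    (α : Hist Γ → PDist A) (τ : Hist Γ) : Prop :=
  ∀ τ' : Hist Γ, τ' ∈ InfoSet sim τ →
    ∀ β : Hist Γ → A → PDist Γ, IsEnvStrat act β →
      ∀ μ : Measure (Play Γ), IsPrMeasure act α β τ' μ → μ (ReachEvent lam) = 1

/-- The set P_∃ of existentially winning abstract states. -/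
def Pexists (act : Γ → A) (sim : Hist Γ → Hist Γ → Prop) (lam : Hist Γ → Bool)
    (h : Hist Γ → P) : Set P :=
  {p | ∃ τ : Hist Γ, h τ = p ∧
    ∃ α : Hist Γ → PDist A, IsPlayerStrat sim α ∧ ASWinFrom act sim lam α τ}

/-- The set P_∀ of universally winning abstract states. -/
def Pforall (act : Γ → A) (sim : Hist Γ → Hist Γ → Prop) (lam : Hist Γ → Bool)
    (h : Hist Γ → P) : Set P :=
  {p | ∀ τ : Hist Γ, h τ = p →
    ∃ α : Hist Γ → PDist A, IsPlayerStrat sim α ∧ ASWinFrom act sim lam α τ}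

end Games


section Helpers

variable {Γ A P : Type}

/-- The uniform distribution on a nonempty finite set. -/
noncomputable def unifDist [Fintype A] (S : Finset A) (hS : S.Nonempty) : PDist A where
  f a := if a ∈ S then 1 / (S.card : ℝ) else 0
  nonneg a := by split_ifs <;> positivity
  sum_one := by
    have : (S.card : ℝ) ≠ 0 := by exact_mod_cast hS.card_pos.ne'
    simp [Finset.sum_ite_mem, this]

/-- The set of actions keeping the game in `Y` (all actions if there are none). -/
noncomputable def allowed [Fintype A] (Y : Set (P ⊕ P × A)) (p : P) : Finset A :=
  if (Finset.univ.filter fun a => Sum.inr (p, a) ∈ Y).Nonempty then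
    Finset.univ.filter fun a => Sum.inr (p, a) ∈ Y else Finset.univ

lemma allowed_nonempty [Fintype A] [Nonempty A] (Y : Set (P ⊕ P × A)) (p : P) :
    (allowed Y p).Nonempty := by
  unfold allowed
  split_ifs with h1
  · exact h1
  · exact Finset.univ_nonempty

lemma mem_allowed [Fintype A] {Y : Set (P ⊕ P × A)} {p : P} {a₀ : A}
    (h0 : Sum.inr (p, a₀) ∈ Y) (a : A) : a ∈ allowed Y p ↔ Sum.inr (p, a) ∈ Y := by
  unfold allowed
  rw [if_pos ⟨a₀, by simpa using h0⟩]
  simp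

/-- One-step transition weight. -/
noncomputable def wt [Fintype Γ] [Fintype A] (act : Γ → A) (α : Hist Γ → PDist A)
    (β : Hist Γ → A → PDist Γ) (τ : Hist Γ) (c : Γ) : ℝ :=
  (α τ).f (act c) * (β τ (act c)).f c

lemma wt_nonneg [Fintype Γ] [Fintype A] (act : Γ → A) (α : Hist Γ → PDist A)
    (β : Hist Γ → A → PDist Γ) (τ : Hist Γ) (c : Γ) : 0 ≤ wt act α β τ c :=
  mul_nonneg ((α τ).nonneg _) ((β τ _).nonneg _)

lemma wt_sum [Fintype Γ] [Fintype A] (act : Γ → A) (α : Hist Γ → PDist A)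
    (β : Hist Γ → A → PDist Γ) (hβ : IsEnvStrat act β) (τ : Hist Γ) (g : A → ℝ) :
    ∑ c, wt act α β τ c * g (act c) = ∑ a, (α τ).f a * g a := by
  have h1 : ∀ c, wt act α β τ c * g (act c) = ∑ a, (α τ).f a * g a * (β τ a).f c := by
    intro c
    rw [Finset.sum_eq_single (act c)]
    · unfold wt; ring
    · intro a _ ha
      have : (β τ a).f c = 0 := by
        by_contra hne
        exact ha (hβ τ a c (lt_of_le_of_ne ((β τ a).nonneg c) (Ne.symm hne))).symm
      rw [this, mul_zero]
    · intro hh; exact absurd (Finset.mem_univ _) hh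
  simp_rw [h1]
  rw [Finset.sum_comm]
  refine Finset.sum_congr rfl fun a _ => ?_
  rw [← Finset.mul_sum, (β τ a).sum_one, mul_one]

lemma wt_sum_one [Fintype Γ] [Fintype A] (act : Γ → A) (α : Hist Γ → PDist A)
    (β : Hist Γ → A → PDist Γ) (hβ : IsEnvStrat act β) (τ : Hist Γ) :
    ∑ c, wt act α β τ c = 1 := by
  have := wt_sum act α β hβ τ (fun _ => 1)
  simpa [(α τ).sum_one] using this

/-- Probability of not having reached the target after `n` further steps. -/
noncomputable def avoidPr [Fintype Γ] [Fintype A] (act : Γ → A) (α : Hist Γ → PDist A)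
    (β : Hist Γ → A → PDist Γ) (lam : Hist Γ → Bool) : ℕ → Hist Γ → ℝ
  | 0, τ => if lam τ = true then 0 else 1
  | n + 1, τ => ∑ c, wt act α β τ c * avoidPr act α β lam n (τ ++ [c])

section
variable [Fintype Γ] [Fintype A] (act : Γ → A) (α : Hist Γ → PDist A)
    (β : Hist Γ → A → PDist Γ) (lam : Hist Γ → Bool)

lemma avoidPr_nonneg (n : ℕ) (τ : Hist Γ) : 0 ≤ avoidPr act α β lam n τ := by
  induction n generalizing τ with
  | zero => unfold avoidPr; split_ifs <;> simp
  | succ n ih =>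
    unfold avoidPr
    exact Finset.sum_nonneg fun c _ => mul_nonneg (wt_nonneg ..) (ih _)

lemma avoidPr_eq_zero (habs : Absorbing lam) (n : ℕ) (τ : Hist Γ) (hτ : lam τ = true) :
    avoidPr act α β lam n τ = 0 := by
  induction n generalizing τ with
  | zero => simp [avoidPr, hτ]
  | succ n ih =>
    unfold avoidPr
    exact Finset.sum_eq_zero fun c _ => by rw [ih _ (habs τ c hτ), mul_zero]

lemma avoidPr_le_one (hβ : IsEnvStrat act β) (lam : Hist Γ → Bool) (n : ℕ) (τ : Hist Γ) : avoidPr act α β lam n τ ≤ 1 := by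
  induction n generalizing τ with
  | zero => unfold avoidPr; split_ifs <;> simp
  | succ n ih =>
    unfold avoidPr
    rw [← wt_sum_one act α β hβ τ]
    exact Finset.sum_le_sum fun c _ => mul_le_of_le_one_right (wt_nonneg ..) (ih _)

lemma avoidPr_succ_le (hβ : IsEnvStrat act β) (lam : Hist Γ → Bool) (habs : Absorbing lam) (n : ℕ) (τ : Hist Γ) :
    avoidPr act α β lam (n + 1) τ ≤ avoidPr act α β lam n τ := by
  induction n generalizing τ with
  | zero =>
    by_cases hτ : lam τ = true
    · rw [avoidPr_eq_zero act α β lam habs _ _ hτ, avoidPr_eq_zero act α β lam habs _ _ hτ]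
    · have : avoidPr act α β lam 0 τ = 1 := by simp [avoidPr, hτ]
      rw [this]; exact avoidPr_le_one act α β hβ lam _ _
  | succ n ih =>
    rw [avoidPr]
    conv_rhs => rw [avoidPr]
    exact Finset.sum_le_sum fun c _ => mul_le_mul_of_nonneg_left (ih _) (wt_nonneg ..)

lemma extProb_append (τ l : Hist Γ) (c : Γ) :
    extProb act α β τ (l ++ [c]) = extProb act α β τ l * wt act α β (τ ++ l) c := by
  induction l generalizing τ with
  | nil => simp [extProb, wt]
  | cons d l ih =>
    simp only [List.cons_append, extProb, ih]
    rw [List.append_assoc, List.singleton_append]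
    ring

lemma extProb_nonneg (τ l : Hist Γ) : 0 ≤ extProb act α β τ l := by
  induction l generalizing τ with
  | nil => simp [extProb]
  | cons d l ih =>
    simp only [extProb]
    exact mul_nonneg (wt_nonneg act α β τ d) (ih _)

lemma measure_cyl {τ : Hist Γ} {μ : Measure (Play Γ)} (hμ : IsPrMeasure act α β τ μ)
    (l : List Γ) : μ (Cyl (τ ++ l)) = ENNReal.ofReal (extProb act α β τ l) := by
  rw [hμ.2]
  split_ifs with h1 h2
  · have : l = [] := by
      have := h1.length_le
      simp at this
      exact this
    simp [this, extProb]
  · simp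
  · exact absurd (List.prefix_append τ l) h2

lemma cyl_subset (ρ : List Γ) : Cyl ρ ⊆ ⋃ c : Γ, Cyl (ρ ++ [c]) := by
  intro π hπ
  refine Set.mem_iUnion.2 ⟨π ρ.length, ?_⟩
  rintro ⟨i, hi⟩
  simp only [List.get_eq_getElem]
  by_cases h1 : i < ρ.length
  · rw [List.getElem_append_left h1]
    exact hπ ⟨i, h1⟩
  · have h2 : i = ρ.length := by simp at hi; omega
    subst h2
    simp

lemma cyl_ofFn {ρ : List Γ} {π : Play Γ} (hπ : π ∈ Cyl ρ) :
    (List.ofFn fun i : Fin ρ.length => π i.1) = ρ := by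
  refine List.ext_getElem (by simp) fun i h1 h2 => ?_
  simp only [List.getElem_ofFn]
  exact hπ ⟨i, h2⟩

lemma measure_avoid {τ : Hist Γ} {μ : Measure (Play Γ)} (hμ : IsPrMeasure act α β τ μ)
    (n : ℕ) (l : List Γ) :
    μ (Cyl (τ ++ l) ∩ (ReachEvent lam)ᶜ) ≤
      ENNReal.ofReal (extProb act α β τ l * avoidPr act α β lam n (τ ++ l)) := by
  induction n generalizing l with
  | zero =>
    by_cases hl : lam (τ ++ l) = true
    · have : Cyl (τ ++ l) ∩ (ReachEvent lam)ᶜ = ∅ := by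
        rw [Set.eq_empty_iff_forall_notMem]
        rintro π ⟨h1, h2⟩
        exact h2 ⟨(τ ++ l).length, by rw [cyl_ofFn h1]; exact hl⟩
      rw [this]; simp
    · simp only [avoidPr, hl]
      rw [if_neg (by simp), mul_one, ← measure_cyl act α β hμ]
      exact measure_mono Set.inter_subset_left
  | succ n ih =>
    calc μ (Cyl (τ ++ l) ∩ (ReachEvent lam)ᶜ)
        ≤ μ (⋃ c : Γ, (Cyl (τ ++ (l ++ [c])) ∩ (ReachEvent lam)ᶜ)) := by
          refine measure_mono ?_
          rw [← Set.iUnion_inter]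
          refine Set.inter_subset_inter_left _ ?_
          simpa using cyl_subset (τ ++ l)
      _ ≤ ∑ c : Γ, μ (Cyl (τ ++ (l ++ [c])) ∩ (ReachEvent lam)ᶜ) :=
          measure_iUnion_fintype_le _ _
      _ ≤ ∑ c : Γ, ENNReal.ofReal (extProb act α β τ (l ++ [c]) *
            avoidPr act α β lam n (τ ++ (l ++ [c]))) := Finset.sum_le_sum fun c _ => ih _
      _ = ENNReal.ofReal (∑ c : Γ, extProb act α β τ (l ++ [c]) *
            avoidPr act α β lam n (τ ++ (l ++ [c]))) := by
          rw [ENNReal.ofReal_sum_of_nonneg]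
          exact fun c _ => mul_nonneg (extProb_nonneg ..) (avoidPr_nonneg ..)
      _ = _ := by
          congr 1
          rw [avoidPr, Finset.mul_sum]
          refine Finset.sum_congr rfl fun c _ => ?_
          rw [extProb_append, List.append_assoc]
          ring

lemma reach_of_avoid_tendsto {τ : Hist Γ} {μ : Measure (Play Γ)}
    (hμ : IsPrMeasure act α β τ μ)
    (hsmall : ∀ ε : ℝ, 0 < ε → ∃ n, avoidPr act α β lam n τ ≤ ε) :
    μ (ReachEvent lam) = 1 := by
  haveI := hμ.1
  have hc : μ (Cyl τ) = 1 := by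
    have := measure_cyl act α β hμ []
    simpa [extProb] using this
  have hm : MeasurableSet (Cyl τ) := MeasurableSpace.measurableSet_generateFrom ⟨τ, rfl⟩
  have hcc : μ (Cyl τ)ᶜ = 0 := (prob_compl_eq_zero_iff hm).2 hc
  have h1 : μ (Cyl τ ∩ (ReachEvent lam)ᶜ) = 0 := by
    refine le_antisymm ?_ zero_le
    refine ENNReal.le_of_forall_pos_le_add fun ε hε _ => ?_
    obtain ⟨n, hn⟩ := hsmall ε (by exact_mod_cast hε)
    have := measure_avoid act α β lam hμ n []
    simp only [List.append_nil, extProb, one_mul] at this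
    refine this.trans ?_
    rw [zero_add]
    exact ENNReal.ofReal_le_of_le_toReal (by simpa using hn)
  have h2 : μ (ReachEvent lam)ᶜ = 0 := by
    refine measure_mono_null (t := (Cyl τ ∩ (ReachEvent lam)ᶜ) ∪ (Cyl τ)ᶜ) ?_
      (measure_union_null h1 hcc)
    intro π hπ
    by_cases h3 : π ∈ Cyl τ
    · exact Or.inl ⟨h3, hπ⟩
    · exact Or.inr h3
  refine le_antisymm prob_le_one ?_
  calc (1 : ENNReal) = μ (ReachEvent lam ∪ (ReachEvent lam)ᶜ) := by
        rw [Set.union_compl_self, measure_univ]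
    _ ≤ μ (ReachEvent lam) + μ (ReachEvent lam)ᶜ := measure_union_le _ _
    _ = μ (ReachEvent lam) := by rw [h2, add_zero]

end

end Helpers

/-- Lemma 2: Y* ∩ P ⊆ P_∀. -/
theorem Ystar_subset_Pforall {Γ A P : Type} [Fintype Γ] [Nonempty Γ] [Fintype A] [Nonempty A] [Fintype P]
    (act : Γ → A) (hact : Function.Surjective act)
    (sim : Hist Γ → Hist Γ → Prop) (hsim : IsIndist act sim)
    (lam : Hist Γ → Bool) (hcons : InfoConsistent sim lam) (habs : Absorbing lam)
    (h : Hist Γ → P) (hh : IsRectMorphism sim lam h)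
    (δP : P → Γ → P) (hδ : ∀ (τ : Hist Γ) (c : Γ), δP (h τ) c = h (τ ++ [c])) :
    {p : P | Sum.inl p ∈ Ystar sim h act δP lam} ⊆ Pforall act sim lam h := by
  classical
  set Y := Ystar sim h act δP lam with hYdef
  have hY1 : OrderHom.lfp (innerOp sim h act δP lam Y) = Y :=
    OrderHom.map_gfp (outerOp sim h act δP lam)
  have hY2 : intr (approxS sim h) Y ∩ (Pre act δP Y ∪ targetS A lam h) = Y := by
    have := OrderHom.map_lfp (innerOp sim h act δP lam Y)
    rw [hY1] at this
    exact this
  have hint : ∀ s ∈ Y, s ∈ intr (approxS sim h) Y := fun s hs => by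
    rw [← hY2] at hs; exact hs.1
  have hpre : ∀ s ∈ Y, s ∈ Pre act δP Y ∪ targetS A lam h := fun s hs => by
    rw [← hY2] at hs; exact hs.2
  have hstepA : ∀ (p : P) (a : A), Sum.inr (p, a) ∈ Y → ∀ c, act c = a →
      Sum.inl (δP p c) ∈ Y := by
    intro p a hpa
    rcases hpre _ hpa with h1 | ⟨_, _, h1⟩
    · exact h1
    · cases h1
  have hstepP : ∀ τ, lam τ ≠ true → Sum.inl (h τ) ∈ Y → ∃ a : A, Sum.inr (h τ, a) ∈ Y := by
    intro τ hl hτ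
    rcases hpre _ hτ with h1 | ⟨q, ⟨τ', h2, h3⟩, h1⟩
    · exact h1
    · cases h1
      exact absurd ((hh.refines _ _ h2).symm.trans h3) hl
  intro p hp τ₀ hτ₀
  set α : Hist Γ → PDist A := fun τ => unifDist (allowed Y (h τ)) (allowed_nonempty Y (h τ))
    with hα
  have hallow : ∀ τ τ', sim τ τ' → allowed Y (h τ) = allowed Y (h τ') := by
    intro τ τ' hs
    have key : ∀ a : A, Sum.inr (h τ, a) ∈ Y ↔ Sum.inr (h τ', a) ∈ Y := fun a =>
      ⟨fun h1 => hint _ h1 (Sum.inr (h τ', a)) ⟨⟨τ', τ, hsim.equiv.symm hs, rfl, rfl⟩, rfl⟩,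
       fun h1 => hint _ h1 (Sum.inr (h τ, a)) ⟨⟨τ, τ', hs, rfl, rfl⟩, rfl⟩⟩
    unfold allowed
    simp only [key]
  refine ⟨α, ?_, ?_⟩
  · intro τ τ' hs
    simp only [hα]
    congr 1
    exact hallow _ _ hs
  intro τ' hτ' β hβ μ hμ
  have hgood0 : Sum.inl (h τ') ∈ Y := by
    have hp' : Sum.inl p ∈ Y := hp
    exact hint _ hp' (Sum.inl (h τ')) ⟨τ', τ₀, hτ', rfl, hτ₀⟩
  refine reach_of_avoid_tendsto act α β lam hμ ?_
  set U := avoidPr act α β lam with hU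
  set d : ℝ := 1 / (Fintype.card A : ℝ) with hd
  have hcard : (1 : ℝ) ≤ Fintype.card A := by exact_mod_cast Fintype.card_pos
  have hd0 : 0 < d := by positivity
  have hd1 : d ≤ 1 := by rw [hd, div_le_one (by linarith)]; exact hcard
  have hαd : ∀ τ a, Sum.inr (h τ, a) ∈ Y → d ≤ (α τ).f a := by
    intro τ a ha
    simp only [hα, unifDist, if_pos ((mem_allowed ha a).2 ha), hd]
    have h1 : 0 < (allowed Y (h τ)).card := (allowed_nonempty Y (h τ)).card_pos
    have h2 : (allowed Y (h τ)).card ≤ Fintype.card A := Finset.card_le_univ _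
    apply one_div_le_one_div_of_le
    · exact_mod_cast h1
    · exact_mod_cast h2
  have hαsupp : ∀ τ a₀, Sum.inr (h τ, a₀) ∈ Y → ∀ a, (α τ).f a ≠ 0 → Sum.inr (h τ, a) ∈ Y := by
    intro τ a₀ h0 a ha
    by_contra hn
    exact ha (by simp only [hα, unifDist, if_neg (fun hm => hn ((mem_allowed h0 a).1 hm))])
  -- uniform bound
  have hrank : ∀ s ∈ Y, ∀ p : P, s = Sum.inl p →
      ∀ᶠ k in Filter.atTop, ∀ τ, h τ = p → U k τ ≤ 1 - d ^ k := by
    let Z : Set (P ⊕ P × A) := {s | s ∈ Y ∧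
      (∀ p : P, s = Sum.inl p → ∀ᶠ k in Filter.atTop, ∀ τ, h τ = p → U k τ ≤ 1 - d ^ k) ∧
      (∀ (p : P) (a : A), s = Sum.inr (p, a) → ∀ᶠ k in Filter.atTop, ∀ τ, h τ = p →
        ∀ c, act c = a → U k (τ ++ [c]) ≤ 1 - d ^ k)}
    have hZ : OrderHom.lfp (innerOp sim h act δP lam Y) ≤ Z := by
      apply OrderHom.lfp_le
      rintro s ⟨hs1, hs2⟩
      have hZY : Z ⊆ Y := fun s hs => hs.1
      have hsY : s ∈ Y := by
        rw [← hY2]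
        exact ⟨hs1, hs2.imp (fun h1 => Pre_mono act δP hZY h1) id⟩
      refine ⟨hsY, ?_, ?_⟩
      · rintro q rfl
        rcases hs2 with ⟨a, h1⟩ | ⟨q', ⟨τ1, h2, h3⟩, h1⟩
        · obtain ⟨k0, hk0⟩ := Filter.eventually_atTop.1 (h1.2.2 q a rfl)
          refine Filter.eventually_atTop.2 ⟨k0 + 1, fun k hk τ hτ => ?_⟩
          obtain ⟨m, rfl⟩ : ∃ m, k = m + 1 := ⟨k - 1, by omega⟩
          have hm := hk0 m (by omega) τ hτ
          have hda := hαd τ a (by rw [hτ]; exact h1.1)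
          have hdm : 0 < d ^ m := by positivity
          calc U (m + 1) τ = ∑ c, wt act α β τ c * U m (τ ++ [c]) := rfl
            _ ≤ ∑ c, wt act α β τ c * (1 - d ^ m * if act c = a then 1 else 0) := by
                refine Finset.sum_le_sum fun c _ =>
                  mul_le_mul_of_nonneg_left ?_ (wt_nonneg ..)
                split_ifs with hc
                · rw [mul_one]; exact hm c hc
                · rw [mul_zero, sub_zero]; exact avoidPr_le_one act α β hβ lam _ _
            _ = ∑ b, (α τ).f b * (1 - d ^ m * if b = a then 1 else 0) :=
                wt_sum act α β hβ τ (fun b => 1 - d ^ m * if b = a then 1 else 0)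
            _ = 1 - d ^ m * (α τ).f a := by
                simp only [mul_sub, mul_one, Finset.sum_sub_distrib, (α τ).sum_one]
                simp [mul_comm]
            _ ≤ 1 - d ^ (m + 1) := by
                rw [pow_succ]
                have := mul_le_mul_of_nonneg_left hda hdm.le
                linarith
        · cases h1
          refine Filter.Eventually.of_forall fun k τ hτ => ?_
          have hl : lam τ = true := by
            rw [← h3]; exact hh.refines _ _ (hτ.trans h2.symm)
          have h0 : U k τ = 0 := avoidPr_eq_zero act α β lam habs k τ hl
          rw [h0]
          have := pow_le_one₀ (n := k) hd0.le hd1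
          linarith
      · rintro q a rfl
        rcases hs2 with h1 | ⟨_, _, h1⟩
        · have h2 : ∀ c : Γ, ∀ᶠ k in Filter.atTop, act c = a → ∀ τ, h τ = δP q c →
              U k τ ≤ 1 - d ^ k := by
            intro c
            by_cases hc : act c = a
            · filter_upwards [(h1 c hc).2.1 _ rfl] with k hk _ using hk
            · exact Filter.Eventually.of_forall fun k hc' => absurd hc' hc
          filter_upwards [Filter.eventually_all.2 h2] with k hk τ hτ c hc
          exact hk c hc _ (by rw [← hτ, hδ])
        · cases h1
    intro s hs
    rw [← hY1] at hs
    exact (hZ hs).2.1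
  obtain ⟨K, hK⟩ : ∃ K, ∀ p : P, Sum.inl p ∈ Y → ∀ τ, h τ = p → U K τ ≤ 1 - d ^ K := by
    have h2 : ∀ p : P, ∀ᶠ k in Filter.atTop, Sum.inl p ∈ Y → ∀ τ, h τ = p →
        U k τ ≤ 1 - d ^ k := by
      intro p
      by_cases hp : Sum.inl p ∈ Y
      · filter_upwards [hrank _ hp p rfl] with k hk _ using hk
      · exact Filter.Eventually.of_forall fun k hp' => absurd hp' hp
    exact (Filter.eventually_all.2 h2).exists
  set q : ℝ := 1 - d ^ K with hq
  have hq0 : 0 ≤ q := by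
    have := pow_le_one₀ (n := K) hd0.le hd1
    linarith
  have hq1 : q < 1 := by
    have : 0 < d ^ K := by positivity
    linarith
  have hcontr : ∀ n τ, Sum.inl (h τ) ∈ Y → U (K + n) τ ≤ q * U n τ := by
    intro n
    induction n with
    | zero =>
      intro τ hτ
      by_cases hl : lam τ = true
      · have h0 : ∀ k, U k τ = 0 := fun k => avoidPr_eq_zero act α β lam habs k τ hl
        rw [h0, h0, mul_zero]
      · have h0 : U 0 τ = 1 := by simp [hU, avoidPr, hl]
        rw [h0, mul_one]
        exact hK _ hτ τ rfl
    | succ n ih =>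
      intro τ hτ
      by_cases hl : lam τ = true
      · have h0 : ∀ k, U k τ = 0 := fun k => avoidPr_eq_zero act α β lam habs k τ hl
        rw [h0, h0, mul_zero]
      · obtain ⟨a, ha⟩ := hstepP τ hl hτ
        calc U (K + (n + 1)) τ = ∑ c, wt act α β τ c * U (K + n) (τ ++ [c]) := rfl
          _ ≤ ∑ c, wt act α β τ c * (q * U n (τ ++ [c])) := by
              refine Finset.sum_le_sum fun c _ => ?_
              by_cases hw : (α τ).f (act c) = 0
              · simp [wt, hw]
              · refine mul_le_mul_of_nonneg_left (ih _ ?_) (wt_nonneg ..)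
                rw [← hδ]
                exact hstepA _ _ (hαsupp τ a ha _ hw) c rfl
          _ = q * ∑ c, wt act α β τ c * U n (τ ++ [c]) := by
              rw [Finset.mul_sum]
              exact Finset.sum_congr rfl fun c _ => by ring
          _ = q * U (n + 1) τ := rfl
  have hpow : ∀ m, U (K * m) τ' ≤ q ^ m := by
    intro m
    induction m with
    | zero => simpa using avoidPr_le_one act α β hβ lam 0 τ'
    | succ m ih =>
      have h1 := hcontr (K * m) τ' hgood0
      rw [Nat.mul_succ, Nat.add_comm, pow_succ, mul_comm (q ^ m)]
      exact h1.trans (mul_le_mul_of_nonneg_left ih hq0)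
  intro ε hε
  obtain ⟨m, hm⟩ := exists_pow_lt_of_lt_one hε hq1
  exact ⟨K * m, (hpow m).trans hm.le⟩
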